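/- Let Y be a real random variable with Gaussian distribution N(μ, σ²) where σ > 0, and let a ∈ ℝ. Then the expected improvement E[max(a − Y, 0)] = (a − μ)·Φ(z) + σ·φ(z), where z = (a − μ)/σ; equivalently E[max(a − Y, 0)] = z·σ·Φ(z) + σ·φ(z). -/

import Mathlib

open MeasureTheory ProbabilityTheory Real

/-- The standard normal probability density function φ(s) = (2π)^{-1/2} exp(−s²/2). -/
noncomputable def stdNormalPDF (s : ℝ) : ℝ :=
  (Real.sqrt (2 * Real.pi))⁻¹ * Real.exp (-(s ^ 2) / 2)

/-- The standard normal cumulative distribution function Φ(t) = ∫_{−∞}^{t} φ(s) ds. -/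
noncomputable def stdNormalCDF (t : ℝ) : ℝ :=
  ∫ s in Set.Iic t, stdNormalPDF s

lemma gaussianPDFReal_zero_one (x : ℝ) : gaussianPDFReal 0 1 x = stdNormalPDF x := by
  simp [gaussianPDFReal, stdNormalPDF]

lemma integrable_stdNormalPDF : Integrable stdNormalPDF :=
  (integrable_gaussianPDFReal 0 1).congr (.of_forall gaussianPDFReal_zero_one)

lemma integrable_mul_stdNormalPDF : Integrable fun x ↦ x * stdNormalPDF x := by
  refine ((integrable_mul_exp_neg_mul_sq (b := 1 / 2) (by norm_num)).const_mul
    (√(2 * π))⁻¹).congr (.of_forall fun x ↦ ?_)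
  simp only [stdNormalPDF]
  ring_nf

lemma hasDerivAt_stdNormalPDF (x : ℝ) : HasDerivAt stdNormalPDF (-(x * stdNormalPDF x)) x := by
  have h : HasDerivAt (fun y : ℝ ↦ -(y ^ 2) / 2) (-x) x :=
    ((hasDerivAt_pow 2 x).neg.div_const 2).congr_deriv (by norm_num; ring)
  exact (h.exp.const_mul (√(2 * π))⁻¹).congr_deriv (by rw [stdNormalPDF]; ring)

/-- The first partial moment of the standard normal law is `-φ`. -/
lemma integral_Iic_mul_stdNormalPDF (z : ℝ) :
    ∫ x in Set.Iic z, x * stdNormalPDF x = -stdNormalPDF z := by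
  have hint : IntegrableOn (fun x ↦ -(x * stdNormalPDF x)) (Set.Iic z) :=
    integrable_mul_stdNormalPDF.neg.integrableOn
  have h := integral_Iic_of_hasDerivAt_of_tendsto' (fun x _ ↦ hasDerivAt_stdNormalPDF x) hint
    (tendsto_zero_of_hasDerivAt_of_integrableOn_Iic (fun x _ ↦ hasDerivAt_stdNormalPDF x) hint
      integrable_stdNormalPDF.integrableOn)
  rw [integral_neg] at h
  linarith

/-- The expected improvement of a standard normal variable below the threshold `z`. -/
lemma integral_max_sub_gaussianReal_zero_one (z : ℝ) :
    ∫ x, max (z - x) 0 ∂gaussianReal 0 1 = z * stdNormalCDF z + stdNormalPDF z := by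
  have hind : (fun x ↦ gaussianPDFReal 0 1 x • max (z - x) 0) =
      (Set.Iic z).indicator fun x ↦ z * stdNormalPDF x - x * stdNormalPDF x := by
    ext x
    rw [gaussianPDFReal_zero_one, smul_eq_mul]
    rcases le_or_gt x z with hx | hx
    · rw [Set.indicator_of_mem (Set.mem_Iic.2 hx), max_eq_left (by linarith)]
      ring
    · rw [Set.indicator_of_notMem (by simpa using hx), max_eq_right (by linarith), mul_zero]
  rw [integral_gaussianReal_eq_integral_smul one_ne_zero, hind,
    integral_indicator measurableSet_Iic,
    integral_sub (integrable_stdNormalPDF.const_mul z).integrableOn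
      integrable_mul_stdNormalPDF.integrableOn, integral_const_mul, integral_Iic_mul_stdNormalPDF,
    stdNormalCDF, sub_neg_eq_add]

lemma gaussianReal_zero_one_map_affine (μ σ : ℝ) :
    (gaussianReal 0 1).map (fun x ↦ μ + σ * x) = gaussianReal μ ⟨σ ^ 2, sq_nonneg σ⟩ := by
  have h : (fun x ↦ μ + σ * x) = (μ + ·) ∘ (σ * ·) := rfl
  rw [h, ← Measure.map_map (by fun_prop) (by fun_prop), gaussianReal_map_const_mul,
    gaussianReal_map_const_add]
  simp only [mul_zero, zero_add, mul_one]
  rfl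

/-- If Y ~ N(μ, σ²) with σ > 0 and a ∈ ℝ, then
E[max(a − Y, 0)] = (a − μ)·Φ(z) + σ·φ(z) = z·σ·Φ(z) + σ·φ(z), with z = (a − μ)/σ. -/
theorem expected_improvement_gaussian {Ω : Type*} [MeasurableSpace Ω]
    (P : Measure Ω) [IsProbabilityMeasure P]
    (Y : Ω → ℝ) (hY : Measurable Y) (μ σ : ℝ) (hσ : 0 < σ)
    (hdist : P.map Y = gaussianReal μ ⟨σ ^ 2, sq_nonneg σ⟩) (a : ℝ) :
    (∫ ω, max (a - Y ω) 0 ∂P)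
        = (a - μ) * stdNormalCDF ((a - μ) / σ) + σ * stdNormalPDF ((a - μ) / σ) ∧
      (∫ ω, max (a - Y ω) 0 ∂P)
        = ((a - μ) / σ) * σ * stdNormalCDF ((a - μ) / σ)
            + σ * stdNormalPDF ((a - μ) / σ) := by
  have hEI : ∫ ω, max (a - Y ω) 0 ∂P =
      (a - μ) * stdNormalCDF ((a - μ) / σ) + σ * stdNormalPDF ((a - μ) / σ) := by
    have hscale (x : ℝ) : max (a - (μ + σ * x)) 0 = σ * max ((a - μ) / σ - x) 0 := by
      rw [mul_max_of_nonneg _ _ hσ.le, mul_zero, mul_sub, mul_div_cancel₀ _ hσ.ne',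
        sub_add_eq_sub_sub]
    rw [← integral_map (f := fun y ↦ max (a - y) 0) hY.aemeasurable
        (by fun_prop), hdist, ← gaussianReal_zero_one_map_affine,
      integral_map (by fun_prop) (by fun_prop)]
    simp_rw [hscale]
    rw [integral_const_mul, integral_max_sub_gaussianReal_zero_one]
    field_simp
  exact ⟨hEI, by rwa [div_mul_cancel₀ _ hσ.ne']⟩
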